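/- arXiv:1406.2040 — 2 statements merged into one kernel-verified Lean document; each statement's English description precedes it below -/
import Mathlib

section
/- Let a ∈ (0,1] and let k ≥ 1 be an integer. There exist constants C > 0 and δ > 0 such that for all x ∈ ℝ with |x| ≤ δ, |arctan(tan x · tan²(arcsin(√a · |sin x|^k))) − a x^{2k+1}| ≤ C · |x|^{2k+3}. (Time-slicing lemma, odd-degree case: composing a PAR circuit with a gearbox circuit implements the odd monomial a x^{2k+1} to leading order.) -/
open Real

theorem abs_arctan_sub_self_le (u : ℝ) : |arctan u - u| ≤ |u| ^ 3 := by
  have key : ∀ v : ℝ, 0 ≤ v → |arctan v - v| ≤ v ^ 3 := by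
    intro v hv
    have h0 : 0 ≤ arctan v := arctan_nonneg.2 hv
    have h1 : arctan v ≤ v := by
      simpa [tan_arctan] using le_tan h0 (arctan_lt_pi_div_two v)
    have h2 : v / √(1 + v ^ 2) ≤ arctan v := by
      simpa [sin_arctan] using sin_le h0
    have h3 : v - v ^ 3 ≤ v / √(1 + v ^ 2) := by
      have hs : 0 < √(1 + v ^ 2) := sqrt_pos.2 (by positivity)
      have hs1 : √(1 + v ^ 2) ≤ 1 + v ^ 2 := by
        rw [sqrt_le_left (by positivity)]
        nlinarith [sq_nonneg v, sq_nonneg (v ^ 2)]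
      have h4 : v / (1 + v ^ 2) ≤ v / √(1 + v ^ 2) := by gcongr
      refine le_trans ?_ h4
      rw [le_div_iff₀ (by positivity)]
      have : 0 ≤ v ^ 5 := by positivity
      linarith [show (v - v ^ 3) * (1 + v ^ 2) = v - v ^ 5 by ring]
    rw [abs_le]
    constructor <;> linarith [pow_nonneg hv 3]
  rcases le_total 0 u with hu | hu
  · simpa [abs_of_nonneg hu] using key u hu
  · have h := key (-u) (by linarith)
    rw [arctan_neg, show -arctan u - -u = -(arctan u - u) by ring, abs_neg] at h
    rwa [abs_of_nonpos hu]

theorem tan_arcsin_sq {y : ℝ} (h₀ : -1 ≤ y) (h₁ : y ≤ 1) :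
    tan (arcsin y) ^ 2 = y ^ 2 / (1 - y ^ 2) := by
  rw [tan_arcsin, div_pow, sq_sqrt]
  nlinarith

theorem abs_sin_sub_self_le {x : ℝ} (hx : |x| ≤ 1) : |sin x - x| ≤ |x| ^ 3 := by
  have h := sin_bound hx
  have h3 : |x ^ 3 / 6| = |x| ^ 3 / 6 := by simp [abs_div, abs_pow]
  have h4 : |x| ^ 5 ≤ |x| ^ 3 := pow_le_pow_of_le_one (abs_nonneg x) hx (by norm_num)
  calc |sin x - x| = |(sin x - (x - x ^ 3 / 6)) + -(x ^ 3 / 6)| := by ring_nf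
    _ ≤ |sin x - (x - x ^ 3 / 6)| + |-(x ^ 3 / 6)| := abs_add_le _ _
    _ ≤ |x| ^ 3 := by
      rw [abs_neg, h3]
      linarith [pow_nonneg (abs_nonneg x) 3]

/-- Time-slicing lemma, odd-degree case: composing a PAR circuit with a gearbox circuit
implements the odd monomial `a x^(2k+1)` to leading order:
`PAR(x, GB(arcsin √a, x, …, x)) = a x^(2k+1) + O(|x|^(2k+3))`. -/
theorem time_slicing_odd (a : ℝ) (ha : 0 < a) (ha1 : a ≤ 1) (k : ℕ) (hk : 1 ≤ k) :
    ∃ C > (0:ℝ), ∃ δ > (0:ℝ), ∀ x : ℝ, |x| ≤ δ →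
      |Real.arctan (Real.tan x *
          Real.tan (Real.arcsin (Real.sqrt a * |Real.sin x| ^ k)) ^ 2)
        - a * x ^ (2 * k + 1)| ≤ C * |x| ^ (2 * k + 3) := by
  refine ⟨2 * k + 12, by positivity, 1 / 2, by norm_num, fun x hx => ?_⟩
  have hx0 := abs_nonneg x
  have hx1 : |x| ≤ 1 := by linarith
  have hs : |sin x| ≤ |x| := abs_sin_le_abs
  have hxsq : x ^ 2 ≤ 1 / 4 := by
    rw [← sq_abs]
    nlinarith
  have hcos := one_sub_sq_div_two_le_cos (x := x)
  have hcos1 := cos_le_one x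
  set t := a * sin x ^ (2 * k) with ht
  have heven : sin x ^ (2 * k) = |sin x| ^ (2 * k) := ((even_two_mul k).pow_abs _).symm
  have ht0 : 0 ≤ t := by rw [ht, heven]; positivity
  have htx : t ≤ x ^ 2 := by
    calc t ≤ 1 * |x| ^ (2 * k) := by rw [ht, heven]; gcongr
      _ ≤ |x| ^ 2 := by
        rw [one_mul]
        exact pow_le_pow_of_le_one hx0 hx1 (by lia)
      _ = x ^ 2 := sq_abs x
  set y := √a * |sin x| ^ k with hy
  have hysq : y ^ 2 = t := by
    rw [hy, ht, mul_pow, sq_sqrt ha.le, heven, ← pow_mul, mul_comm k 2]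
  have hyabs : |y| ≤ 1 := abs_le_one_iff_mul_self_le_one.2 (by nlinarith)
  rw [tan_arcsin_sq (abs_le.1 hyabs).1 (abs_le.1 hyabs).2, hysq, tan_eq_sin_div_cos]
  set D := cos x * (1 - t) with hD
  have hDlow : 1 - 3 / 2 * x ^ 2 ≤ D := by nlinarith
  have hDone : D ≤ 1 := by nlinarith
  have hDpos : 5 / 8 ≤ D := by linarith
  set m := a * sin x ^ (2 * k + 1) with hm
  have hu : sin x / cos x * (t / (1 - t)) = m / D := by
    rw [div_mul_div_comm, ht, hm]
    ring
  rw [hu]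
  have hmabs : |m| ≤ |x| ^ (2 * k + 1) := by
    rw [hm, abs_mul, abs_pow, abs_of_pos ha]
    calc a * |sin x| ^ (2 * k + 1) ≤ 1 * |x| ^ (2 * k + 1) := by gcongr
      _ = _ := one_mul _
  have hD0 : 0 < D := by linarith
  have huabs : |m / D| ≤ 2 * |x| ^ (2 * k + 1) := by
    rw [abs_div, abs_of_pos hD0, div_le_iff₀ hD0]
    nlinarith [pow_nonneg hx0 (2 * k + 1)]
  have harctan : |arctan (m / D) - m / D| ≤ 8 * |x| ^ (2 * k + 3) := by
    calc _ ≤ |m / D| ^ 3 := abs_arctan_sub_self_le _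
      _ ≤ (2 * |x| ^ (2 * k + 1)) ^ 3 := by gcongr
      _ = 8 * |x| ^ (6 * k + 3) := by ring
      _ ≤ 8 * |x| ^ (2 * k + 3) := by
        gcongr 8 * ?_
        exact pow_le_pow_of_le_one hx0 hx1 (by lia)
  have hquot : |m / D - m| ≤ 3 * |x| ^ (2 * k + 3) := by
    rw [show m / D - m = m * (1 - D) / D by field_simp, abs_div, abs_mul, abs_of_pos hD0,
      abs_of_nonneg (by linarith : 0 ≤ 1 - D), div_le_iff₀ hD0]
    calc |m| * (1 - D) ≤ |x| ^ (2 * k + 1) * (3 / 2 * |x| ^ 2) := by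
          gcongr
          rw [sq_abs]; linarith
      _ = 3 / 2 * |x| ^ (2 * k + 3) := by ring
      _ ≤ 3 * |x| ^ (2 * k + 3) * D := by nlinarith [pow_nonneg hx0 (2 * k + 3)]
  have hmono : |m - a * x ^ (2 * k + 1)| ≤ (2 * k + 1) * |x| ^ (2 * k + 3) := by
    rw [hm, ← mul_sub, abs_mul, abs_of_pos ha]
    calc a * |sin x ^ (2 * k + 1) - x ^ (2 * k + 1)|
        ≤ 1 * (|sin x - x| * (2 * k + 1 : ℕ) * max |sin x| |x| ^ (2 * k + 1 - 1)) := by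
          gcongr
          exact abs_pow_sub_pow_le _ _ _
      _ ≤ 1 * (|x| ^ 3 * (2 * k + 1 : ℕ) * |x| ^ (2 * k)) := by
          rw [max_eq_right hs, Nat.add_sub_cancel]
          gcongr
          exact abs_sin_sub_self_le hx1
      _ = _ := by push_cast; ring
  calc |arctan (m / D) - a * x ^ (2 * k + 1)|
      = |(arctan (m / D) - m / D) + (m / D - m) + (m - a * x ^ (2 * k + 1))| := by ring_nf
    _ ≤ |arctan (m / D) - m / D| + |m / D - m| + |m - a * x ^ (2 * k + 1)| := abs_add_three _ _ _
    _ ≤ (2 * k + 12) * |x| ^ (2 * k + 3) := by linarith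
end

section
/- Fix a, b ∈ ℝ and set γ := arcsin(1/√6). Define h(x) := π/4 − arctan(tan²(arcsin((1/√6)·|sin(ax)|))) − arctan(tan²(arcsin((1/√6)·|sin(bx)|))). There exist constants C > 0 and δ > 0 such that for all x with |x| ≤ δ, |arctan(tan(ax) · tan(bx) · tan(h(x))) − a b x²| ≤ C · x⁶. (Correctness of the sixth-order multiplication formula M₆.) -/
open Real

open Asymptotics Filter Topology

/-- A function vanishing at `0` whose derivative is `O(x ^ n)` near `0` is `O(x ^ (n + 1))`. -/
theorem isBigO_pow_succ_of_hasDerivAt {f f' : ℝ → ℝ} {n : ℕ} (h0 : f 0 = 0)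
    (hf : ∀ᶠ x in 𝓝 0, HasDerivAt f (f' x) x) (hf' : f' =O[𝓝 0] fun x : ℝ => x ^ n) :
    f =O[𝓝 0] fun x : ℝ => x ^ (n + 1) := by
  obtain ⟨c, hc⟩ := hf'.bound
  obtain ⟨ε, hε, h⟩ := Metric.eventually_nhds_iff_ball.1 (hf.and hc)
  refine IsBigO.of_bound c ?_
  filter_upwards [Metric.ball_mem_nhds (0 : ℝ) hε] with x hx
  have hx' : |x| < ε := by simpa using hx
  have hball : ∀ y ∈ Metric.closedBall (0 : ℝ) |x|, y ∈ Metric.ball (0 : ℝ) ε := fun y hy => by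
    have hy' : |y| ≤ |x| := by simpa using hy
    simpa using hy'.trans_lt hx'
  have hc0 : 0 ≤ c * |x| ^ n := by
    simpa using (norm_nonneg _).trans (h x hx).2
  have key := (convex_closedBall (0 : ℝ) |x|).norm_image_sub_le_of_norm_hasDerivWithin_le
    (f := f) (f' := f') (C := c * |x| ^ n) (x := 0) (y := x)
    (fun y hy => (h y (hball y hy)).1.hasDerivWithinAt)
    (fun y hy => by
      have hy' : |y| ≤ |x| := by simpa using hy
      have h1 := (h y (hball y hy)).2
      rw [norm_pow, Real.norm_eq_abs y] at h1
      rcases le_or_gt 0 c with hcn | hcn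
      · exact h1.trans (by gcongr)
      · have h2 : c * |y| ^ n ≤ 0 := mul_nonpos_of_nonpos_of_nonneg hcn.le (by positivity)
        linarith)
    (by simp) (by simp)
  simpa [h0, pow_succ, mul_assoc] using key

theorem tan_isBigO : Real.tan =O[𝓝 0] fun x : ℝ => x := by
  have h := (Real.hasDerivAt_tan (x := 0) (by simp)).isBigO_sub
  simpa using h

theorem eventually_hasDerivAt_tan :
    ∀ᶠ x in 𝓝 (0 : ℝ), HasDerivAt Real.tan (1 + Real.tan x ^ 2) x := by
  have hcos : ∀ᶠ x in 𝓝 (0 : ℝ), Real.cos x ≠ 0 :=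
    Real.continuous_cos.continuousAt.eventually_ne (by simp)
  filter_upwards [hcos] with x hx
  convert Real.hasDerivAt_tan hx using 1
  rw [Real.tan_eq_sin_div_cos]
  field_simp
  linarith [Real.sin_sq_add_cos_sq x]

theorem tan_sub_self_isBigO : (fun x => Real.tan x - x) =O[𝓝 0] fun x : ℝ => x ^ 3 := by
  refine isBigO_pow_succ_of_hasDerivAt (f' := fun x => Real.tan x ^ 2) (by simp) ?_
    (tan_isBigO.pow 2)
  filter_upwards [eventually_hasDerivAt_tan] with x hx
  exact (hx.sub (hasDerivAt_id x)).congr_deriv (by ring)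

theorem tan_sub_cubic_isBigO :
    (fun x => Real.tan x - (x + x ^ 3 / 3)) =O[𝓝 0] fun x : ℝ => x ^ 5 := by
  refine isBigO_pow_succ_of_hasDerivAt (f' := fun x => (Real.tan x - x) * (Real.tan x + x))
    (by simp) ?_ ?_
  · filter_upwards [eventually_hasDerivAt_tan] with x hx
    exact (hx.sub ((hasDerivAt_id x).add ((hasDerivAt_pow 3 x).div_const 3))).congr_deriv
      (by push_cast; ring)
  · exact (tan_sub_self_isBigO.mul (tan_isBigO.add (isBigO_refl _ _))).congr_right
      fun x => by ring

theorem sin_sq_sub_sq_isBigO : (fun x => Real.sin x ^ 2 - x ^ 2) =O[𝓝 0] fun x : ℝ => x ^ 4 := by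
  refine isBigO_pow_succ_of_hasDerivAt (f' := fun x => 2 * (Real.sin x * Real.cos x - x))
    (by simp) ?_ (IsBigO.const_mul_left ?_ 2)
  · filter_upwards with x
    exact (((Real.hasDerivAt_sin x).pow 2).sub (hasDerivAt_pow 2 x)).congr_deriv
      (by push_cast; ring)
  · refine isBigO_pow_succ_of_hasDerivAt (f' := fun x => -2 * Real.sin x ^ 2) (by simp) ?_
      (IsBigO.const_mul_left (IsBigO.pow ?_ 2) _)
    · filter_upwards with x
      exact (((Real.hasDerivAt_sin x).mul (Real.hasDerivAt_cos x)).sub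
        (hasDerivAt_id x)).congr_deriv (by linarith [Real.sin_sq_add_cos_sq x])
    · simpa using (Real.hasDerivAt_sin 0).isBigO_sub

theorem arctan_sub_self_isBigO : (fun x => Real.arctan x - x) =O[𝓝 0] fun x : ℝ => x ^ 3 := by
  refine isBigO_pow_succ_of_hasDerivAt (f' := fun x => 1 / (1 + x ^ 2) - 1) (by simp)
    (.of_forall fun x => (Real.hasDerivAt_arctan x).sub (hasDerivAt_id x)) ?_
  refine IsBigO.of_bound 1 (.of_forall fun x => ?_)
  have h : 1 / (1 + x ^ 2) - 1 = -(x ^ 2 / (1 + x ^ 2)) := by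
    field_simp
    ring
  rw [h, norm_neg, Real.norm_of_nonneg (by positivity), Real.norm_of_nonneg (by positivity),
    one_mul]
  exact div_le_self (by positivity) (by nlinarith [sq_nonneg x])

theorem tan_arcsin_sq_of_sin (θ : ℝ) :
    Real.tan (Real.arcsin ((1 / Real.sqrt 6) * |Real.sin θ|)) ^ 2 =
      Real.sin θ ^ 2 / (6 - Real.sin θ ^ 2) := by
  have h := Real.sin_sq_le_one θ
  have h6 : ((1 / Real.sqrt 6) * |Real.sin θ|) ^ 2 = Real.sin θ ^ 2 / 6 := by
    rw [mul_pow, div_pow, Real.sq_sqrt (by norm_num), sq_abs]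
    ring
  rw [Real.tan_arcsin, div_pow, h6, Real.sq_sqrt (by linarith)]
  have : 6 - Real.sin θ ^ 2 ≠ 0 := by linarith
  have : 1 - Real.sin θ ^ 2 / 6 ≠ 0 := by linarith
  field_simp

theorem tan_pi_div_four_sub_arctan_sub_arctan {p q : ℝ} (hp : 0 ≤ p) (hq : 0 ≤ q)
    (hpq : p * q < 1) :
    Real.tan (π / 4 - Real.arctan p - Real.arctan q) =
      (1 - p * q - (p + q)) / (1 - p * q + (p + q)) := by
  have hd : 0 < 1 - p * q := by linarith
  have ht : 0 ≤ (p + q) / (1 - p * q) := by positivity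
  rw [sub_sub, Real.arctan_add hpq, ← Real.arctan_one, sub_eq_add_neg, ← Real.arctan_neg,
    Real.arctan_add (by linarith), Real.tan_arctan]
  have h1 : 1 - p * q + (p + q) ≠ 0 := by positivity
  have h2 : 1 - 1 * -((p + q) / (1 - p * q)) ≠ 0 := by
    rw [one_mul, sub_neg_eq_add]
    positivity
  rw [div_eq_div_iff h2 h1]
  field_simp
  ring

theorem tan_correction (u v : ℝ) :
    Real.tan (π / 4
        - Real.arctan (Real.tan (Real.arcsin ((1 / Real.sqrt 6) * |Real.sin u|)) ^ 2)
        - Real.arctan (Real.tan (Real.arcsin ((1 / Real.sqrt 6) * |Real.sin v|)) ^ 2)) =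
      1 - (Real.sin u ^ 2 + Real.sin v ^ 2) / 3 +
        Real.sin u ^ 2 * Real.sin v ^ 2 *
          ((2 - (Real.sin u ^ 2 + Real.sin v ^ 2) / 3) /
            (18 - Real.sin u ^ 2 * Real.sin v ^ 2)) := by
  rw [tan_arcsin_sq_of_sin, tan_arcsin_sq_of_sin]
  have hA := Real.sin_sq_le_one u
  have hB := Real.sin_sq_le_one v
  have hA0 := sq_nonneg (Real.sin u)
  have hB0 := sq_nonneg (Real.sin v)
  generalize Real.sin u ^ 2 = A at *
  generalize Real.sin v ^ 2 = B at *
  have hAB : A * B ≤ 1 := mul_le_one₀ hA hB0 hB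
  have h1 : 0 < 6 - A := by linarith
  have h2 : 0 < 6 - B := by linarith
  have h3 : 18 - A * B ≠ 0 := by linarith
  have hpq : A / (6 - A) * (B / (6 - B)) < 1 := by
    rw [div_mul_div_comm, div_lt_one (by positivity)]
    nlinarith
  rw [tan_pi_div_four_sub_arctan_sub_arctan (by positivity) (by positivity) hpq]
  have h4 : 1 - A / (6 - A) * (B / (6 - B)) + (A / (6 - A) + B / (6 - B)) =
      2 * (18 - A * B) / ((6 - A) * (6 - B)) := by
    field_simp
    ring
  rw [h4]
  field_simp
  ring

theorem tan_correction_isBigO (a b : ℝ) :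
    (fun x : ℝ => Real.tan (π / 4
        - Real.arctan (Real.tan (Real.arcsin ((1 / Real.sqrt 6) * |Real.sin (a * x)|)) ^ 2)
        - Real.arctan (Real.tan (Real.arcsin ((1 / Real.sqrt 6) * |Real.sin (b * x)|)) ^ 2))
        - (1 - (a ^ 2 + b ^ 2) / 3 * x ^ 2)) =O[𝓝 0] fun x : ℝ => x ^ 4 := by
  have hsq (c : ℝ) : (fun x => Real.sin (c * x) ^ 2 - (c * x) ^ 2) =O[𝓝 0] fun x : ℝ => x ^ 4 := by
    have ht : Tendsto (fun x : ℝ => c * x) (𝓝 0) (𝓝 0) := by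
      simpa using (continuous_const_mul c).tendsto 0
    refine (sin_sq_sub_sq_isBigO.comp_tendsto ht).trans ?_
    exact (isBigO_const_mul_self c (fun x : ℝ => x) _).pow 4
  have hs (c : ℝ) : (fun x => Real.sin (c * x) ^ 2) =O[𝓝 0] fun x : ℝ => x ^ 2 := by
    refine IsBigO.pow ?_ 2
    refine IsBigO.of_bound |c| (.of_forall fun x => ?_)
    simpa [abs_mul] using Real.abs_sin_le_abs (x := c * x)
  have hbdd : (fun x : ℝ => (2 - (Real.sin (a * x) ^ 2 + Real.sin (b * x) ^ 2) / 3) /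
      (18 - Real.sin (a * x) ^ 2 * Real.sin (b * x) ^ 2)) =O[𝓝 0] fun _ : ℝ => (1 : ℝ) := by
    refine Tendsto.isBigO_one ℝ
      (ContinuousAt.tendsto (.div (by fun_prop) (by fun_prop) (by simp)))
  have hprod := (((hs a).mul (hs b)).mul hbdd).congr_right
    (g₂ := fun x : ℝ => x ^ 4) fun x => by ring
  refine ((((hsq a).add (hsq b)).const_mul_left (-1 / 3)).add hprod).congr_left fun x => ?_
  rw [tan_correction]
  ring

theorem tan_mul_tan_isBigO (a b : ℝ) :
    (fun x : ℝ => Real.tan (a * x) * Real.tan (b * x)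
      - a * b * x ^ 2 * (1 + (a ^ 2 + b ^ 2) / 3 * x ^ 2)) =O[𝓝 0] fun x : ℝ => x ^ 6 := by
  have ht (c : ℝ) : Tendsto (fun x : ℝ => c * x) (𝓝 0) (𝓝 0) := by
    simpa using (continuous_const_mul c).tendsto 0
  have hc (c : ℝ) : (fun x : ℝ => c * x) =O[𝓝 0] fun x : ℝ => x :=
    isBigO_const_mul_self c (fun x : ℝ => x) _
  have h1 (c : ℝ) : (fun x : ℝ => Real.tan (c * x)) =O[𝓝 0] fun x : ℝ => x :=
    (tan_isBigO.comp_tendsto (ht c)).trans (hc c)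
  have h5 (c : ℝ) : (fun x : ℝ => Real.tan (c * x) - (c * x + (c * x) ^ 3 / 3))
      =O[𝓝 0] fun x : ℝ => x ^ 5 :=
    (tan_sub_cubic_isBigO.comp_tendsto (ht c)).trans ((hc c).pow 5)
  have hp : (fun x : ℝ => a + a ^ 3 * x ^ 2 / 3) =O[𝓝 0] fun _ : ℝ => (1 : ℝ) :=
    Tendsto.isBigO_one ℝ (ContinuousAt.tendsto (by fun_prop))
  have hp' := ((isBigO_refl (fun x : ℝ => x) (𝓝 0)).mul hp).mul (h5 b)
  have h6 := ((h5 a).mul (h1 b)).congr_right (g₂ := fun x : ℝ => x ^ 6) fun x => by ring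
  have h6' := hp'.congr_right (g₂ := fun x : ℝ => x ^ 6) fun x => by ring
  have h7 : (fun x : ℝ => a ^ 3 * b ^ 3 / 9 * x ^ 6) =O[𝓝 0] fun x : ℝ => x ^ 6 :=
    isBigO_const_mul_self _ _ _
  exact ((h6.add h6').add h7).congr_left fun x => by ring

theorem arctan_comp_isBigO {f : ℝ → ℝ} {c : ℝ}
    (hf : (fun x => f x - c * x ^ 2) =O[𝓝 0] fun x : ℝ => x ^ 6) :
    (fun x => Real.arctan (f x) - c * x ^ 2) =O[𝓝 0] fun x : ℝ => x ^ 6 := by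
  have hpow : (fun x : ℝ => x ^ 6) =O[𝓝 0] fun x : ℝ => x ^ 2 := by
    refine ((isBigO_refl (fun x : ℝ => x ^ 2) (𝓝 0)).mul
      (Tendsto.isBigO_one (f' := fun x : ℝ => x ^ 4) ℝ
        (ContinuousAt.tendsto (by fun_prop)))).congr ?_ ?_
    all_goals intro x; ring
  have hf2 : f =O[𝓝 0] fun x : ℝ => x ^ 2 :=
    ((hf.trans hpow).add (isBigO_const_mul_self c (fun x : ℝ => x ^ 2) _)).congr_left
      fun x => by ring
  have ht : Tendsto f (𝓝 0) (𝓝 0) := by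
    refine hf2.trans_tendsto ?_
    simpa using (continuous_pow 2).tendsto (0 : ℝ)
  have h3 := ((arctan_sub_self_isBigO.comp_tendsto ht).trans (hf2.pow 3)).congr_right
    (g₂ := fun x : ℝ => x ^ 6) fun x => by ring
  exact (h3.add hf).congr_left fun x => by simp

/-- Correctness of the sixth-order multiplication formula `M₆` of the paper:
with `h(x) = π/4 − GB(γ, ax) − GB(γ, bx)` where `γ = arcsin(1/√6)`, one has
`PAR(ax, bx, h(x)) = arctan(tan(ax)·tan(bx)·tan(h(x))) = abx² + O(x⁶)`. -/
theorem M6_sixth_order (a b : ℝ) :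
    ∃ C > (0:ℝ), ∃ δ > (0:ℝ), ∀ x : ℝ, |x| ≤ δ →
      |Real.arctan (Real.tan (a * x) * Real.tan (b * x) *
          Real.tan (π / 4
            - Real.arctan (Real.tan (Real.arcsin ((1 / Real.sqrt 6) * |Real.sin (a * x)|)) ^ 2)
            - Real.arctan (Real.tan (Real.arcsin ((1 / Real.sqrt 6) * |Real.sin (b * x)|)) ^ 2)))
        - a * b * x ^ 2| ≤ C * x ^ 6 := by
  have hT := tan_mul_tan_isBigO a b
  have hR := tan_correction_isBigO a b
  have hp : (fun x : ℝ => 1 - (a ^ 2 + b ^ 2) / 3 * x ^ 2) =O[𝓝 0] fun _ : ℝ => (1 : ℝ) :=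
    Tendsto.isBigO_one ℝ (ContinuousAt.tendsto (by fun_prop))
  have htan (c : ℝ) : (fun x : ℝ => Real.tan (c * x)) =O[𝓝 0] fun x : ℝ => x := by
    refine (tan_isBigO.comp_tendsto ?_).trans (isBigO_const_mul_self c (fun x : ℝ => x) _)
    simpa using (continuous_const_mul c).tendsto 0
  have h1 := (hT.mul hp).congr_right (g₂ := fun x : ℝ => x ^ 6) fun x => by ring
  have h2 := (((htan a).mul (htan b)).mul hR).congr_right (g₂ := fun x : ℝ => x ^ 6)
    fun x => by ring
  have h3 : (fun x : ℝ => -(a * b * ((a ^ 2 + b ^ 2) / 3) ^ 2) * x ^ 6) =O[𝓝 0]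
      fun x : ℝ => x ^ 6 := isBigO_const_mul_self _ _ _
  have h := arctan_comp_isBigO (c := a * b) (((h1.add h2).add h3).congr_left fun x => by
    rw [show ∀ T R w : ℝ, (T - a * b * x ^ 2 * (1 + w * x ^ 2)) * (1 - w * x ^ 2) +
        T * (R - (1 - w * x ^ 2)) + -(a * b * w ^ 2) * x ^ 6 = T * R - a * b * x ^ 2 from
      fun T R w => by ring])
  obtain ⟨c, hc, hb⟩ := h.exists_pos
  obtain ⟨ε, hε, hball⟩ := Metric.eventually_nhds_iff_ball.1 hb.bound
  refine ⟨c, hc, ε / 2, by positivity, fun x hx => ?_⟩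
  have hx' := hball x (by simpa using hx.trans_lt (half_lt_self hε))
  rwa [Real.norm_eq_abs, Real.norm_of_nonneg (by positivity)] at hx'
end
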